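/- Let $\mu, \nu$ be compactly supported probability measures on $\mathbb{R}^3$ with bounded densities, let $p \in (1,\infty)$ and let $\mathcal{W}_\infty$ denote the $\infty$-Wasserstein distance. Then there is a constant $C$ depending only on $p$ such that $\|\mu - \nu\|_{(W^{1,p}(\mathbb{R}^3))^*} \leq C\, (\|\mu\|_{L^\infty} + \|\nu\|_{L^\infty})^{1/p}\, \mathcal{W}_\infty(\mu,\nu)$. -/

import Mathlib

open MeasureTheory

/-- `π` is a coupling (transport plan) between `μ` and `ν`. -/
def IsCoupling {E : Type*} [MeasurableSpace E]
    (π : Measure (E × E)) (μ ν : Measure E) : Prop :=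
  π.map Prod.fst = μ ∧ π.map Prod.snd = ν

open Metric Set
open scoped ENNReal

section DualSobolev

variable {E : Type*} [NormedAddCommGroup E] [NormedSpace ℝ E]

/-- The increment of a `C¹` function is controlled by the mean of its derivative along the
segment. -/
lemma enorm_sub_le_mul_lintegral_fderiv {v : E → ℝ} (hv : ContDiff ℝ 1 v) (a w : E) :
    ‖v (a + w) - v a‖ₑ ≤ ‖w‖ₑ * ∫⁻ t in Ioc (0 : ℝ) 1, ‖fderiv ℝ v (a + t • w)‖ₑ := by
  have hpath : Continuous fun t : ℝ => a + t • w := by fun_prop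
  have hcont : Continuous fun t : ℝ => fderiv ℝ v (a + t • w) :=
    (hv.continuous_fderiv one_ne_zero).comp hpath
  have hderiv : ∀ t ∈ uIcc (0 : ℝ) 1,
      HasDerivAt (fun t : ℝ => v (a + t • w)) (fderiv ℝ v (a + t • w) w) t := fun t _ => by
    have hline : HasDerivAt (fun t : ℝ => a + t • w) w t := by
      simpa using ((hasDerivAt_id t).smul_const w).const_add a
    exact ((hv.differentiable one_ne_zero _).hasFDerivAt).comp_hasDerivAt t hline
  have hftc := intervalIntegral.integral_eq_sub_of_hasDerivAt hderiv
    ((hcont.clm_apply continuous_const).intervalIntegrable 0 1)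
  rw [intervalIntegral.integral_of_le zero_le_one] at hftc
  simp only [one_smul, zero_smul, add_zero] at hftc
  rw [← hftc, ← lintegral_const_mul _ hcont.enorm.measurable]
  refine (enorm_integral_le_lintegral_enorm _).trans (lintegral_mono fun t => ?_)
  rw [mul_comm]
  exact ContinuousLinearMap.le_opENorm _ _

variable [MeasurableSpace E] [BorelSpace E]

/-- A `C¹` function and its translate by `h` differ by at most `‖h‖` times the mean of
the derivative bound `B`. -/
lemma lintegral_enorm_translate_sub_le {μ : Measure E} [SFinite μ] {v : E → ℝ}
    (hv : ContDiff ℝ 1 v) {B : ℝ≥0∞} (hB : ∀ h, ∫⁻ x, ‖fderiv ℝ v (x + h)‖ₑ ∂μ ≤ B) (h : E) :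
    ∫⁻ x, ‖v (x + h) - v x‖ₑ ∂μ ≤ ‖h‖ₑ * B := by
  have hcont := hv.continuous_fderiv one_ne_zero
  have hjoint : Continuous fun z : E × ℝ => ‖fderiv ℝ v (z.1 + z.2 • h)‖ₑ :=
    (hcont.comp (by fun_prop)).enorm
  calc ∫⁻ x, ‖v (x + h) - v x‖ₑ ∂μ
      ≤ ∫⁻ x, ‖h‖ₑ * (∫⁻ t in Ioc (0 : ℝ) 1, ‖fderiv ℝ v (x + t • h)‖ₑ) ∂μ :=
        lintegral_mono fun x => enorm_sub_le_mul_lintegral_fderiv hv x h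
    _ = ‖h‖ₑ * ∫⁻ t in Ioc (0 : ℝ) 1, ∫⁻ x, ‖fderiv ℝ v (x + t • h)‖ₑ ∂μ := by
        rw [lintegral_const_mul' _ _ enorm_ne_top,
          lintegral_lintegral_swap hjoint.measurable.aemeasurable]
    _ ≤ ‖h‖ₑ * ∫⁻ _ in Ioc (0 : ℝ) 1, B := by gcongr with t; exact hB _
    _ = ‖h‖ₑ * B := by simp

variable [FiniteDimensional ℝ E]

/-- Hölder's inequality against the translate of a function, for a probability measure with
bounded density. -/
lemma lintegral_enorm_add_le_eLpNorm {F : Type*} [NormedAddCommGroup F]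
    {lam μ : Measure E} [lam.IsAddHaarMeasure] [IsProbabilityMeasure μ] {M : ℝ≥0∞}
    (hM : M ≠ 0) (hμ : μ ≤ M • lam) {q : ℝ≥0∞} (hq : 1 ≤ q) {f : E → F}
    (hf : Continuous f) (h : E) :
    ∫⁻ x, ‖f (x + h)‖ₑ ∂μ ≤ M ^ (1 / q.toReal) * eLpNorm f q lam := by
  have hfh : Continuous fun x => f (x + h) := by fun_prop
  have hmp : MeasurePreserving (fun x : E => x + h) lam lam := measurePreserving_add_right lam h
  calc ∫⁻ x, ‖f (x + h)‖ₑ ∂μ = eLpNorm (fun x => f (x + h)) 1 μ :=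
        eLpNorm_one_eq_lintegral_enorm.symm
    _ ≤ eLpNorm (fun x => f (x + h)) q μ :=
        eLpNorm_le_eLpNorm_of_exponent_le hq hfh.aestronglyMeasurable
    _ ≤ eLpNorm (fun x => f (x + h)) q (M • lam) := eLpNorm_mono_measure _ hμ
    _ = M ^ (1 / q.toReal) * eLpNorm (fun x => f (x + h)) q lam := by
        rw [eLpNorm_smul_measure_of_ne_zero hM, smul_eq_mul, ENNReal.toReal_div]; simp
    _ = M ^ (1 / q.toReal) * eLpNorm f q lam := by
        rw [← eLpNorm_comp_measurePreserving hf.aestronglyMeasurable hmp]; rfl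

/-- Averaging over translations in a ball of radius `W` makes the increments over distances at
most `W` comparable to the mean of the derivative over a ball of radius `2 * W`. -/
lemma setLIntegral_ball_enorm_sub_le {lam : Measure E} [lam.IsAddHaarMeasure] {v : E → ℝ}
    (hv : ContDiff ℝ 1 v) {W : ℝ} {x y : E} (hxy : dist x y ≤ W) :
    ∫⁻ h in ball (0 : E) W, ‖v (y + h) - v (x + h)‖ₑ ∂lam ≤
      ENNReal.ofReal W * ∫⁻ k in ball (0 : E) (2 * W), ‖fderiv ℝ v (x + k)‖ₑ ∂lam := by
  have hcont := hv.continuous_fderiv one_ne_zero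
  have hjoint : Continuous fun z : E × ℝ => ‖fderiv ℝ v (x + z.1 + z.2 • (y - x))‖ₑ :=
    (hcont.comp (by fun_prop)).enorm
  have hnorm : ‖y - x‖ ≤ W := by rwa [← dist_eq_norm, dist_comm]
  have henorm : ‖y - x‖ₑ ≤ ENNReal.ofReal W := by
    rw [← ofReal_norm]; exact ENNReal.ofReal_le_ofReal hnorm
  have hshift : ∀ t ∈ Ioc (0 : ℝ) 1,
      ∫⁻ h in ball (0 : E) W, ‖fderiv ℝ v (x + h + t • (y - x))‖ₑ ∂lam ≤
        ∫⁻ k in ball (0 : E) (2 * W), ‖fderiv ℝ v (x + k)‖ₑ ∂lam := by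
    intro t ht
    rw [← lintegral_indicator measurableSet_ball, ← lintegral_indicator measurableSet_ball,
      ← lintegral_add_right_eq_self ((ball (0 : E) (2 * W)).indicator _) (t • (y - x))]
    refine lintegral_mono fun h => ?_
    by_cases hh : h ∈ ball (0 : E) W
    · have hmem : h + t • (y - x) ∈ ball (0 : E) (2 * W) := by
        rw [mem_ball_zero_iff] at hh ⊢
        have hsmul : ‖t • (y - x)‖ ≤ W := by
          rw [norm_smul, Real.norm_of_nonneg ht.1.le]
          nlinarith [norm_nonneg (y - x), ht.1, ht.2]
        linarith [norm_add_le h (t • (y - x))]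
      rw [indicator_of_mem hh, indicator_of_mem hmem, add_assoc]
    · simp [indicator_of_notMem hh]
  calc ∫⁻ h in ball (0 : E) W, ‖v (y + h) - v (x + h)‖ₑ ∂lam
      ≤ ∫⁻ h in ball (0 : E) W, ‖y - x‖ₑ *
          (∫⁻ t in Ioc (0 : ℝ) 1, ‖fderiv ℝ v (x + h + t • (y - x))‖ₑ) ∂lam := by
        refine lintegral_mono fun h => ?_
        have := enorm_sub_le_mul_lintegral_fderiv hv (x + h) (y - x)
        rwa [show x + h + (y - x) = y + h by abel] at this
    _ = ‖y - x‖ₑ * ∫⁻ t in Ioc (0 : ℝ) 1, ∫⁻ h in ball (0 : E) W,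
          ‖fderiv ℝ v (x + h + t • (y - x))‖ₑ ∂lam := by
        rw [lintegral_const_mul' _ _ enorm_ne_top,
          lintegral_lintegral_swap hjoint.measurable.aemeasurable]
    _ ≤ ENNReal.ofReal W * ∫⁻ _ in Ioc (0 : ℝ) 1,
          ∫⁻ k in ball (0 : E) (2 * W), ‖fderiv ℝ v (x + k)‖ₑ ∂lam := by
        gcongr ?_ * ?_
        exact setLIntegral_mono' measurableSet_Ioc hshift
    _ = _ := by simp

/-- A coupling moving mass by at most `W` changes the values of a `C¹` function, on average, by at
most a multiple of `W` times a bound `B` for the means of the translated derivative. -/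
lemma lintegral_coupling_enorm_sub_le (lam : Measure E) [lam.IsAddHaarMeasure]
    {μ ν : Measure E} {π : Measure (E × E)} [SFinite π] (hπ : IsCoupling π μ ν)
    {W : ℝ} (hW : 0 < W) (hdist : ∀ᵐ z ∂π, dist z.1 z.2 ≤ W) {v : E → ℝ} (hv : ContDiff ℝ 1 v)
    {B : ℝ≥0∞} (hμ : ∀ h, ∫⁻ x, ‖fderiv ℝ v (x + h)‖ₑ ∂μ ≤ B)
    (hν : ∀ h, ∫⁻ x, ‖fderiv ℝ v (x + h)‖ₑ ∂ν ≤ B) :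
    ∫⁻ z, ‖v z.1 - v z.2‖ₑ ∂π ≤
      (2 ^ Module.finrank ℝ E + 2) * (ENNReal.ofReal W * B) := by
  have hcont := hv.continuous_fderiv one_ne_zero
  have hvc := hv.continuous
  obtain ⟨rfl, rfl⟩ := hπ
  have hmap₁ : ∀ f : E → ℝ≥0∞, Measurable f →
      ∫⁻ z, f z.1 ∂π = ∫⁻ x, f x ∂π.map Prod.fst := fun f hf =>
    (lintegral_map hf measurable_fst).symm
  have hmap₂ : ∀ f : E → ℝ≥0∞, Measurable f →
      ∫⁻ z, f z.2 ∂π = ∫⁻ x, f x ∂π.map Prod.snd := fun f hf =>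
    (lintegral_map hf measurable_snd).symm
  set b : ℝ≥0∞ := lam (ball (0 : E) W) with hb
  have hb0 : b ≠ 0 := (measure_ball_pos lam 0 hW).ne'
  have hbtop : b ≠ ∞ := measure_ball_lt_top.ne
  have hb2 : lam (ball (0 : E) (2 * W)) = 2 ^ Module.finrank ℝ E * b := by
    rw [Measure.addHaar_ball_mul_of_pos lam 0 two_pos, ENNReal.ofReal_pow zero_le_two]
    simp [hb]
  have hball : ∀ h ∈ ball (0 : E) W, ‖h‖ₑ * B ≤ ENNReal.ofReal W * B := fun h hh => by
    gcongr
    rw [← ofReal_norm]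
    exact ENNReal.ofReal_le_ofReal (mem_ball_zero_iff.1 hh).le
  have htranslate₁ : ∀ h ∈ ball (0 : E) W,
      ∫⁻ z : E × E, ‖v (z.1 + h) - v z.1‖ₑ ∂π ≤ ENNReal.ofReal W * B := fun h hh => by
    rw [hmap₁ (fun x => ‖v (x + h) - v x‖ₑ) (by fun_prop)]
    exact (lintegral_enorm_translate_sub_le hv hμ h).trans (hball h hh)
  have htranslate₂ : ∀ h ∈ ball (0 : E) W,
      ∫⁻ z : E × E, ‖v (z.2 + h) - v z.2‖ₑ ∂π ≤ ENNReal.ofReal W * B := fun h hh => by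
    rw [hmap₂ (fun x => ‖v (x + h) - v x‖ₑ) (by fun_prop)]
    exact (lintegral_enorm_translate_sub_le hv hν h).trans (hball h hh)
  have hsplit : ∀ (h : E) (z : E × E), ‖v z.1 - v z.2‖ₑ ≤
      ‖v (z.1 + h) - v z.1‖ₑ + ‖v (z.2 + h) - v z.2‖ₑ + ‖v (z.2 + h) - v (z.1 + h)‖ₑ := by
    intro h z
    calc ‖v z.1 - v z.2‖ₑ
        = ‖-(v (z.1 + h) - v z.1) + (v (z.2 + h) - v z.2) - (v (z.2 + h) - v (z.1 + h))‖ₑ := by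
          congr 1; ring
      _ ≤ _ := by
          refine enorm_sub_le.trans ?_
          gcongr
          refine (enorm_add_le _ _).trans ?_
          rw [enorm_neg]
  have hmiddle : ∫⁻ h in ball (0 : E) W, ∫⁻ z : E × E, ‖v (z.2 + h) - v (z.1 + h)‖ₑ ∂π ∂lam ≤
      ENNReal.ofReal W * (2 ^ Module.finrank ℝ E * b * B) := by
    have hjoint : Continuous fun q : E × (E × E) => ‖v (q.2.2 + q.1) - v (q.2.1 + q.1)‖ₑ := by
      fun_prop
    have hjoint' : Continuous fun q : (E × E) × E => ‖fderiv ℝ v (q.1.1 + q.2)‖ₑ :=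
      (hcont.comp (by fun_prop)).enorm
    rw [lintegral_lintegral_swap hjoint.measurable.aemeasurable]
    calc ∫⁻ z : E × E, ∫⁻ h in ball (0 : E) W, ‖v (z.2 + h) - v (z.1 + h)‖ₑ ∂lam ∂π
        ≤ ∫⁻ z : E × E, ENNReal.ofReal W *
            ∫⁻ k in ball (0 : E) (2 * W), ‖fderiv ℝ v (z.1 + k)‖ₑ ∂lam ∂π :=
          lintegral_mono_ae <| hdist.mono fun z hz => setLIntegral_ball_enorm_sub_le hv hz
      _ = ENNReal.ofReal W * ∫⁻ k in ball (0 : E) (2 * W),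
            ∫⁻ z : E × E, ‖fderiv ℝ v (z.1 + k)‖ₑ ∂π ∂lam := by
          rw [lintegral_const_mul' _ _ ENNReal.ofReal_ne_top,
            lintegral_lintegral_swap hjoint'.measurable.aemeasurable]
      _ ≤ ENNReal.ofReal W * ∫⁻ _ in ball (0 : E) (2 * W), B ∂lam := by
          gcongr with k
          rw [hmap₁ (fun x => ‖fderiv ℝ v (x + k)‖ₑ)
            (hcont.comp (continuous_add_const k)).enorm.measurable]
          exact hμ k
      _ = _ := by rw [setLIntegral_const, hb2, mul_comm B]
  have hmain : b * ∫⁻ z, ‖v z.1 - v z.2‖ₑ ∂π ≤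
      b * ((2 ^ Module.finrank ℝ E + 2) * (ENNReal.ofReal W * B)) := by
    calc b * ∫⁻ z, ‖v z.1 - v z.2‖ₑ ∂π
        = ∫⁻ _ in ball (0 : E) W, ∫⁻ z, ‖v z.1 - v z.2‖ₑ ∂π ∂lam := by
          rw [setLIntegral_const, mul_comm]
      _ ≤ ∫⁻ h in ball (0 : E) W, (ENNReal.ofReal W * B + ENNReal.ofReal W * B +
            ∫⁻ z : E × E, ‖v (z.2 + h) - v (z.1 + h)‖ₑ ∂π) ∂lam := by
          refine setLIntegral_mono' measurableSet_ball fun h hh => ?_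
          refine (lintegral_mono (hsplit h)).trans ?_
          rw [lintegral_add_left (by fun_prop), lintegral_add_left (by fun_prop)]
          gcongr
          exacts [htranslate₁ h hh, htranslate₂ h hh]
      _ ≤ (ENNReal.ofReal W * B + ENNReal.ofReal W * B) * b +
            ENNReal.ofReal W * (2 ^ Module.finrank ℝ E * b * B) := by
          rw [lintegral_add_left measurable_const, setLIntegral_const]
          gcongr
      _ = _ := by ring
  exact (ENNReal.mul_le_mul_iff_right hb0 hbtop).1 hmain

end DualSobolev

/-- **Dual Sobolev norm vs. infinite Wasserstein distance.**
For compactly supported probability measures `μ, ν` on `ℝ³` with densities bounded by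
`Mμ, Mν` and any coupling moving mass at most distance `W`, every `v ∈ W^{1,p}(ℝ³)`
satisfies `|∫ v dμ - ∫ v dν| ≤ C (Mμ + Mν)^{1/p} W ‖v‖_{W^{1,p}}`, i.e.
`‖μ - ν‖_{(W^{1,p})^*} ≤ C (‖μ‖_∞ + ‖ν‖_∞)^{1/p} 𝒲_∞(μ,ν)`. -/
theorem dual_sobolev_wasserstein (p : ℝ) (hp : 1 < p) :
    ∃ C : ℝ, 0 < C ∧
      ∀ (μ ν : Measure (EuclideanSpace ℝ (Fin 3)))
        (_ : IsProbabilityMeasure μ) (_ : IsProbabilityMeasure ν)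
        (Kμ Kν : Set (EuclideanSpace ℝ (Fin 3))), IsCompact Kμ → IsCompact Kν →
        μ Kμᶜ = 0 → ν Kνᶜ = 0 →
        ∀ Mμ Mν : ℝ, 0 < Mμ → 0 < Mν →
        μ ≤ ENNReal.ofReal Mμ • (volume : Measure (EuclideanSpace ℝ (Fin 3))) →
        ν ≤ ENNReal.ofReal Mν • (volume : Measure (EuclideanSpace ℝ (Fin 3))) →
        ∀ (π : Measure (EuclideanSpace ℝ (Fin 3) × EuclideanSpace ℝ (Fin 3))),
          IsCoupling π μ ν →
        ∀ W : ℝ, (∀ᵐ z ∂π, dist z.1 z.2 ≤ W) →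
        ∀ v : EuclideanSpace ℝ (Fin 3) → ℝ, ContDiff ℝ 1 v → HasCompactSupport v →
          |∫ x, v x ∂μ - ∫ x, v x ∂ν| ≤
            C * (Mμ + Mν) ^ ((1 : ℝ) / p) * W *
              ((eLpNorm v (ENNReal.ofReal p) volume).toReal +
                (eLpNorm (fun x => ‖fderiv ℝ v x‖) (ENNReal.ofReal p) volume).toReal) := by
  refine ⟨10, by norm_num, ?_⟩
  intro μ ν _ _ _ _ _ _ _ _ Mμ Mν hMμ hMν hμ hν π hπ W hdist v hv hvc
  have hfst : π.map Prod.fst = μ := hπ.1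
  have hsnd : π.map Prod.snd = ν := hπ.2
  have hprob : IsProbabilityMeasure π := by
    constructor
    rw [← measure_univ (μ := μ), ← hfst, Measure.map_apply measurable_fst .univ, preimage_univ]
  have hW : 0 ≤ W := by
    obtain ⟨z, hz⟩ := hdist.exists
    exact dist_nonneg.trans hz
  have hint₁ : Integrable (fun z : EuclideanSpace ℝ (Fin 3) × EuclideanSpace ℝ (Fin 3) => v z.1)
      π := by
    have := hv.continuous.integrable_of_hasCompactSupport (μ := μ) hvc
    rw [← hfst] at this
    exact this.comp_measurable measurable_fst
  have hint₂ : Integrable (fun z : EuclideanSpace ℝ (Fin 3) × EuclideanSpace ℝ (Fin 3) => v z.2)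
      π := by
    have := hv.continuous.integrable_of_hasCompactSupport (μ := ν) hvc
    rw [← hsnd] at this
    exact this.comp_measurable measurable_snd
  have hdiff : ∫ x, v x ∂μ - ∫ x, v x ∂ν = ∫ z, (v z.1 - v z.2) ∂π := by
    rw [integral_sub hint₁ hint₂, ← hfst, ← hsnd,
      integral_map measurable_fst.aemeasurable hv.continuous.aestronglyMeasurable,
      integral_map measurable_snd.aemeasurable hv.continuous.aestronglyMeasurable]
  rw [hdiff]
  rcases hW.eq_or_lt with rfl | hWpos
  · have hzero : ∀ᵐ z ∂π, v z.1 - v z.2 = 0 := hdist.mono fun z hz => by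
      rw [dist_le_zero.1 hz, sub_self]
    rw [integral_eq_zero_of_ae hzero]
    simp
  have hcont := hv.continuous_fderiv one_ne_zero
  have hp0 : 0 < p := zero_lt_one.trans hp
  have hM : 0 < Mμ + Mν := add_pos hMμ hMν
  have hq : 1 ≤ ENNReal.ofReal p := by simpa using hp.le
  set G := eLpNorm (fun x => ‖fderiv ℝ v x‖) (ENNReal.ofReal p) volume with hG
  have hGtop : G ≠ ∞ := by
    rw [hG, eLpNorm_norm]
    exact (hcont.memLp_of_hasCompactSupport (hvc.fderiv (𝕜 := ℝ))).eLpNorm_ne_top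
  have hbound : ∀ (ρ : Measure (EuclideanSpace ℝ (Fin 3))) [IsProbabilityMeasure ρ],
      ρ ≤ ENNReal.ofReal (Mμ + Mν) • volume → ∀ h, ∫⁻ x, ‖fderiv ℝ v (x + h)‖ₑ ∂ρ ≤
        ENNReal.ofReal (Mμ + Mν) ^ (1 / p) * G := fun ρ _ hρ h => by
    have := lintegral_enorm_add_le_eLpNorm (ENNReal.ofReal_pos.2 hM).ne' hρ hq hcont h
    rwa [ENNReal.toReal_ofReal hp0.le, ← eLpNorm_norm] at this
  have hmono : ∀ {m : ℝ}, m ≤ Mμ + Mν →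
      ENNReal.ofReal m • (volume : Measure (EuclideanSpace ℝ (Fin 3))) ≤
        ENNReal.ofReal (Mμ + Mν) • volume := fun hm => by
    gcongr
  have hcoupling := lintegral_coupling_enorm_sub_le volume hπ hWpos hdist hv
    (hbound μ (hμ.trans (hmono (by linarith)))) (hbound ν (hν.trans (hmono (by linarith))))
  rw [finrank_euclideanSpace_fin] at hcoupling
  have hnum : (2 ^ 3 + 2 : ℝ≥0∞) = ENNReal.ofReal 10 := by norm_num
  rw [hnum, ENNReal.ofReal_rpow_of_pos hM, ← ENNReal.ofReal_toReal hGtop,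
    ← ENNReal.ofReal_mul (by positivity), ← ENNReal.ofReal_mul hW,
    ← ENNReal.ofReal_mul (by norm_num)] at hcoupling
  have hreal : |∫ z, (v z.1 - v z.2) ∂π| ≤
      10 * (W * ((Mμ + Mν) ^ (1 / p) * G.toReal)) := by
    have := (enorm_integral_le_lintegral_enorm _).trans hcoupling
    rwa [← ofReal_norm, ENNReal.ofReal_le_ofReal_iff (by positivity),
      Real.norm_eq_abs] at this
  calc |∫ z, (v z.1 - v z.2) ∂π|
      ≤ 10 * (Mμ + Mν) ^ (1 / p) * W * G.toReal := hreal.trans_eq (by ring)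
    _ ≤ _ := by
      gcongr
      exact le_add_of_nonneg_left ENNReal.toReal_nonneg
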